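/- Let φ(s) = c₀·s + ψ(s), where c₀ ≥ 2 is an integer and ψ(s) = ∑_{n≥1} c_n n^{−s} is a Dirichlet series converging uniformly on ℂ_ε for every ε > 0 that is either identically 0 or satisfies ψ(ℂ₀) ⊂ ℂ₀, and suppose the composition operator C_φ is bounded and compact on ℋ². Then there exist constants A > 0 and c > 0 such that a_n(C_φ) ≥ c·n^{−A} for all n ≥ 1. -/

import Mathlib

open Complex Filter MeasureTheory

noncomputable section

/-- The Hilbert space `ℋ²` of Dirichlet series with square-summable coefficients,
modeled by its coefficient sequences (indexed by `ℕ+`). -/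
abbrev H2 := ↥(lp (fun _ : ℕ+ => ℂ) 2)

/-- The Dirichlet series attached to an element of `ℋ²`; it converges on `Re s > 1/2`. -/
noncomputable def H2series (x : H2) (s : ℂ) : ℂ := ∑' n : ℕ+, x n * (n : ℂ) ^ (-s)

/-- `T` is (the bounded operator realizing) the composition operator `C_φ` on `ℋ²`:
for every `f ∈ ℋ²`, the Dirichlet series of `T f` agrees with `f ∘ φ` on `ℂ_{1/2}`. -/
def IsCompOp (φ : ℂ → ℂ) (T : H2 →L[ℂ] H2) : Prop :=
  ∀ (x : H2) (s : ℂ), 1 / 2 < s.re → H2series (T x) s = H2series x (φ s)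

/-- The `n`-th approximation number of a bounded operator: the distance in operator
norm to the operators of rank `< n`. -/
noncomputable def approxNumber {E F : Type*} [NormedAddCommGroup E] [NormedSpace ℂ E]
    [NormedAddCommGroup F] [NormedSpace ℂ F] (T : E →L[ℂ] F) (n : ℕ) : ℝ :=
  sInf {c : ℝ | ∃ R : E →L[ℂ] F,
    FiniteDimensional ℂ (LinearMap.range (R : E →ₗ[ℂ] F)) ∧
    Module.finrank ℂ (LinearMap.range (R : E →ₗ[ℂ] F)) < n ∧ c = ‖T - R‖}

/-- The Dirichlet series with coefficients `c` converges uniformly on `ℂ_ε = {Re s > ε}`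
for every `ε > 0`, with sum `φ`. -/
def DSConvUnif (c : ℕ → ℂ) (φ : ℂ → ℂ) : Prop :=
  ∀ ε : ℝ, 0 < ε →
    TendstoUniformlyOn (fun N s => ∑ n ∈ Finset.range N, LSeries.term c s n) φ
      atTop {s : ℂ | ε < s.re}

section LSeriesLemmas

open LSeries

/-- If `∑ f n n⁻ˢ = M⁻ˢ exp (-κ ∑ c n n⁻ˢ)`, then `f` is supported on the multiples of `M`. -/
lemma LSeries_coeff_eq_zero_of_eq_cpow_mul_exp {f c : ℕ → ℂ} {M : ℕ} (hM : M ≠ 0) {κ : ℂ}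
    (hf : abscissaOfAbsConv f < ⊤) (hc : abscissaOfAbsConv c < ⊤) {σ : ℝ}
    (h : ∀ s : ℂ, σ < s.re → LSeries f s = (M : ℂ) ^ (-s) * exp (-κ * LSeries c s))
    {n : ℕ} (hn : n ≠ 0) (hMn : ¬ M ∣ n) : f n = 0 := by
  have hM' : (M : ℂ) ≠ 0 := Nat.cast_ne_zero.mpr hM
  set g : ℕ → ℂ := log M • f - κ • LSeries.convolution (logMul c) f with hg
  have hconvol : abscissaOfAbsConv (LSeries.convolution (logMul c) f) < ⊤ :=
    (abscissaOfAbsConv_convolution_le _ _).trans_lt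
      (max_lt (abscissaOfAbsConv_logMul.trans_lt hc) hf)
  have hg_lt : abscissaOfAbsConv g < ⊤ :=
    (abscissaOfAbsConv_sub_le _ _).trans_lt <| max_lt
      ((abscissaOfAbsConv_binop_le (F := fun f _ => log M • f)
        (fun hf _ => hf.smul _) f f).trans_lt (max_lt hf hf))
      ((abscissaOfAbsConv_binop_le (F := fun f _ => κ • f)
        (fun hf _ => hf.smul _) _ _).trans_lt (max_lt hconvol hconvol))
  obtain ⟨τ, hτ, -⟩ := EReal.exists_between_coe_real (max_lt hf hc)
  have key : (fun x : ℝ => LSeries (logMul f) x) =ᶠ[atTop] fun x => LSeries g x := by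
    filter_upwards [eventually_gt_atTop (max σ τ)] with x hx
    have hxσ : σ < (x : ℂ).re := (le_max_left _ _).trans_lt hx
    have hxτ : (τ : EReal) < (x : ℂ).re := EReal.coe_lt_coe_iff.mpr ((le_max_right _ _).trans_lt hx)
    have hfx : abscissaOfAbsConv f < (x : ℂ).re := ((le_max_left _ _).trans_lt hτ).trans hxτ
    have hcx : abscissaOfAbsConv c < (x : ℂ).re := ((le_max_right _ _).trans_lt hτ).trans hxτ
    have hcx' : abscissaOfAbsConv (logMul c) < (x : ℂ).re := abscissaOfAbsConv_logMul.trans_lt hcx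
    have hsf := LSeriesSummable_of_abscissaOfAbsConv_lt_re hfx
    have hsc := LSeriesSummable_of_abscissaOfAbsConv_lt_re hcx'
    have h1 := LSeries_hasDerivAt hfx
    have h2 : HasDerivAt (fun s : ℂ => (M : ℂ) ^ (-s) * exp (-κ * LSeries c s))
        ((M : ℂ) ^ (-(x : ℂ)) * log M * (-1) * exp (-κ * LSeries c x) +
          (M : ℂ) ^ (-(x : ℂ)) * (exp (-κ * LSeries c x) * (-κ * -LSeries (logMul c) x))) x :=
      ((hasDerivAt_id (x : ℂ)).neg.const_cpow (Or.inl hM')).mul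
        (((LSeries_hasDerivAt hcx).const_mul (-κ)).cexp)
    have hev : LSeries f =ᶠ[nhds (x : ℂ)]
        fun s : ℂ => (M : ℂ) ^ (-s) * exp (-κ * LSeries c s) := by
      filter_upwards [(isOpen_lt continuous_const Complex.continuous_re).mem_nhds hxσ] with s hs
      exact h s hs
    have h3 := h1.unique (h2.congr_of_eventuallyEq hev)
    rw [hg, LSeries_sub (hsf.smul _) ((hsc.convolution hsf).smul _), LSeries_smul, LSeries_smul,
      LSeries_convolution' hsc hsf, h x hxσ]
    linear_combination -h3
  have hrec : ∀ k : ℕ, k ≠ 0 → log k * f k = log M * f k -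
      κ * LSeries.convolution (logMul c) f k := fun k hk => by
    simpa [hg, logMul] using
      eq_of_LSeries_eventually_eq (abscissaOfAbsConv_logMul.trans_lt hf) hg_lt key hk
  induction n using Nat.strong_induction_on with
  | _ n ih =>
    have hzero : LSeries.convolution (logMul c) f n = 0 := by
      rw [LSeries.convolution_def]
      refine Finset.sum_eq_zero fun p hp => ?_
      obtain ⟨hp1, hp2⟩ := Nat.ne_zero_of_mem_divisorsAntidiagonal hp
      have hpn := (Nat.mem_divisorsAntidiagonal.mp hp).1
      rcases eq_or_ne p.1 1 with h1 | h1
      · simp [logMul, h1]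
      · rw [ih p.2 (by rw [← hpn]; exact lt_mul_left (Nat.pos_of_ne_zero hp2) (by omega)) hp2
          fun hd => hMn (hpn ▸ hd.mul_left _), mul_zero]
    have hlog : (log n - log M) * f n = 0 := by
      rw [sub_mul, hrec n hn, hzero]; ring
    refine (mul_eq_zero.mp hlog).resolve_left fun hsub => hMn ?_
    rw [sub_eq_zero, ← ofReal_natCast, ← ofReal_natCast, ← ofReal_log (by positivity),
      ← ofReal_log (by positivity), ofReal_inj] at hsub
    have := Real.log_injOn_pos (Set.mem_Ioi.mpr (by positivity)) (Set.mem_Ioi.mpr (by positivity))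
      hsub
    exact (Nat.cast_injective this).symm.dvd

/-- If `∑ f n n⁻ˢ = M⁻ˢ exp (-κ ∑ c n n⁻ˢ)`, then the coefficient of `f` at `M` is
`exp (-κ c₁)`. -/
lemma LSeries_coeff_eq_exp_of_eq_cpow_mul_exp {f c : ℕ → ℂ} {M : ℕ} (hM : M ≠ 0) {κ : ℂ}
    (hf0 : f 0 = 0) (hf : abscissaOfAbsConv f < ⊤) (hc : abscissaOfAbsConv c < ⊤) {σ : ℝ}
    (h : ∀ s : ℂ, σ < s.re → LSeries f s = (M : ℂ) ^ (-s) * exp (-κ * LSeries c s)) :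
    f M = exp (-κ * c 1) := by
  have hM' : (M : ℂ) ≠ 0 := Nat.cast_ne_zero.mpr hM
  obtain ⟨m, rfl⟩ := Nat.exists_eq_succ_of_ne_zero hM
  have hlow : ∀ k ≤ m, f k = 0 := fun k hk => by
    rcases eq_or_ne k 0 with rfl | hk0
    · exact hf0
    · exact LSeries_coeff_eq_zero_of_eq_cpow_mul_exp hM hf hc h hk0
        fun hd => by have := Nat.le_of_dvd (Nat.pos_of_ne_zero hk0) hd; omega
  refine tendsto_nhds_unique (tendsto_cpow_mul_atTop hlow hf) ?_
  refine Tendsto.congr' ?_ ((continuous_exp.tendsto _).comp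
    ((LSeries.tendsto_atTop hc).const_mul (-κ)))
  filter_upwards [eventually_gt_atTop σ] with x hx
  have hMx : ((m + 1 : ℕ) : ℂ) ^ (x : ℂ) ≠ 0 := by
    rw [Ne, cpow_eq_zero_iff]; exact fun h0 => hM' h0.1
  rw [h x (by simpa using hx), cpow_neg, ← mul_assoc]
  push_cast at hMx ⊢
  rw [mul_inv_cancel₀ hMx, one_mul]
  rfl

end LSeriesLemmas

/-- A uniformly convergent Dirichlet series on every `ℂ_ε` has a finite abscissa of absolute
convergence. -/
lemma DSConvUnif.abscissaOfAbsConv_lt_top {c : ℕ → ℂ} {ψ : ℂ → ℂ} (h : DSConvUnif c ψ) :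
    LSeries.abscissaOfAbsConv c < ⊤ := by
  have hlim := (h 1 one_pos).tendsto_at (x := 2) (by simp)
  have hterm : Tendsto (fun n => LSeries.term c 2 n) atTop (nhds 0) := by
    have := (hlim.comp (tendsto_add_atTop_nat 1)).sub hlim
    simpa [Finset.sum_range_succ, Function.comp_def] using this
  have hO : c =O[atTop] fun n : ℕ => (n : ℝ) ^ (2 : ℝ) := by
    refine Asymptotics.IsBigO.of_bound 1 ?_
    filter_upwards [hterm.norm.eventually_lt_const (by simp : ‖(0 : ℂ)‖ < 1),
      eventually_gt_atTop 0] with n hn hn0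
    have hn0' : (0 : ℝ) < n := Nat.cast_pos.mpr hn0
    rw [LSeries.term_of_ne_zero hn0.ne', norm_div, norm_natCast_cpow_of_pos hn0, re_ofNat,
      div_lt_one (by positivity)] at hn
    rw [one_mul, Real.norm_of_nonneg (by positivity)]
    exact hn.le
  exact (LSeries.abscissaOfAbsConv_le_of_isBigO_rpow hO).trans_lt
    (by exact_mod_cast EReal.coe_lt_top _)

/-- On its half-plane of absolute convergence, the sum of the series is its `LSeries`. -/
lemma DSConvUnif.eq_LSeries {c : ℕ → ℂ} {ψ : ℂ → ℂ} (h : DSConvUnif c ψ) {s : ℂ} (hs : 0 < s.re)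
    (hs' : LSeriesSummable c s) : ψ s = LSeries c s :=
  tendsto_nhds_unique ((h (s.re / 2) (by positivity)).tendsto_at (by simpa using hs))
    hs'.hasSum.tendsto_sum_nat

/-- The coefficients of an element of `ℋ²`, as a function on `ℕ` vanishing at `0`. -/
def H2coeff (x : H2) (n : ℕ) : ℂ := if h : 0 < n then x ⟨n, h⟩ else 0

lemma H2coeff_zero (x : H2) : H2coeff x 0 = 0 := rfl

lemma H2coeff_coe (x : H2) (n : ℕ+) : H2coeff x n = x n := dif_pos n.pos

lemma abscissaOfAbsConv_H2coeff_lt_top (x : H2) :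
    LSeries.abscissaOfAbsConv (H2coeff x) < ⊤ := by
  refine (LSeries.abscissaOfAbsConv_le_of_le_const ⟨‖x‖, fun n hn => ?_⟩).trans_lt
    (EReal.coe_lt_top 1)
  simpa [H2coeff, Nat.pos_of_ne_zero hn] using lp.norm_apply_le_norm two_ne_zero x _

lemma H2series_eq_LSeries (x : H2) (s : ℂ) : H2series x s = LSeries (H2coeff x) s := by
  rw [H2series, LSeries, ← PNat.coe_injective.tsum_eq]
  · refine tsum_congr fun n => ?_
    rw [LSeries.term_of_ne_zero n.ne_zero, H2coeff_coe, cpow_neg, div_eq_mul_inv]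
  · intro n hn
    refine ⟨⟨n, Nat.pos_of_ne_zero ?_⟩, rfl⟩
    rintro rfl
    simp at hn

lemma H2series_single (m : ℕ+) (s : ℂ) : H2series (lp.single 2 m 1) s = (m : ℂ) ^ (-s) := by
  rw [H2series, tsum_eq_single m fun n hn => by simp [Pi.single_eq_of_ne hn]]
  simp

/-- If a compression of `T` to coordinates is diagonal with entries of modulus at least `δ`, then
the corresponding approximation number of `T` is at least `δ`. -/
lemma le_approxNumber_of_diagonal (T : H2 →L[ℂ] H2) {N : ℕ} (hN : 1 ≤ N) {a b : Fin N → ℕ+}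
    (ha : a.Injective) (hb : b.Injective) {d : Fin N → ℂ} {δ : ℝ} (hδ : 0 ≤ δ)
    (hd : ∀ i, δ ≤ ‖d i‖) (hdiag : ∀ i, T (lp.single 2 (a i) 1) (b i) = d i)
    (hoff : ∀ i j, i ≠ j → T (lp.single 2 (a j) 1) (b i) = 0) : δ ≤ approxNumber T N := by
  refine le_csInf ⟨_, 0, ?_, ?_, rfl⟩ ?_
  · rw [ContinuousLinearMap.toLinearMap_zero, LinearMap.range_zero]; infer_instance
  · rw [ContinuousLinearMap.toLinearMap_zero, LinearMap.range_zero]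
    simpa using Nat.pos_of_ne_zero (by omega)
  rintro _ ⟨R, hfin, hrank, rfl⟩
  let J : (Fin N → ℂ) →ₗ[ℂ] H2 :=
    Fintype.linearCombination ℂ fun i => (lp.single 2 (a i) 1 : H2)
  have hJ : ∀ v, J v = ∑ i, v i • (lp.single 2 (a i) 1 : H2) := fun v =>
    Fintype.linearCombination_apply ..
  obtain ⟨v, hv, hv0⟩ : ∃ v, (R : H2 →ₗ[ℂ] H2).rangeRestrict (J v) = 0 ∧ v ≠ 0 := by
    have := LinearMap.ker_ne_bot_of_finrank_lt (f := (R : H2 →ₗ[ℂ] H2).rangeRestrict ∘ₗ J)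
      (by simpa using hrank)
    obtain ⟨v, hv, hv0⟩ := Submodule.exists_mem_ne_zero_of_ne_bot this
    exact ⟨v, hv, hv0⟩
  have hRv : R (J v) = 0 := congrArg Subtype.val hv
  have hJnorm : ‖J v‖ ^ 2 = ∑ i, ‖v i‖ ^ 2 := by
    have hJ' : J v = ∑ k ∈ Finset.univ.image a, lp.single 2 k (Function.extend a v 0 k) := by
      rw [Finset.sum_image ha.injOn, hJ]
      refine Finset.sum_congr rfl fun i _ => ?_
      rw [ha.extend_apply, ← lp.single_smul, smul_eq_mul, mul_one]
    have := lp.norm_sum_single (p := 2) (E := fun _ : ℕ+ => ℂ) (by simp)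
      (Function.extend a v 0) (Finset.univ.image a)
    rw [← hJ', Finset.sum_image ha.injOn] at this
    simpa [ha.extend_apply] using this
  have hTJ : ∀ i, T (J v) (b i) = d i * v i := fun i => by
    rw [hJ, map_sum, lp.coeFn_sum, Finset.sum_apply, Finset.sum_eq_single i]
    · simp [hdiag, mul_comm]
    · intro j _ hj
      simp [hoff i j hj.symm]
    · simp
  have hlow : ∑ i, ‖d i * v i‖ ^ 2 ≤ ‖T (J v)‖ ^ 2 := by
    have := lp.sum_rpow_le_norm_rpow (by simp) (T (J v)) (Finset.univ.image b)
    rw [Finset.sum_image hb.injOn] at this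
    simpa [hTJ] using this
  have hpos : 0 < ‖J v‖ := by
    obtain ⟨i, hi⟩ := Function.ne_iff.mp hv0
    have hsq : 0 < ‖J v‖ ^ 2 := hJnorm ▸ Finset.sum_pos' (fun i _ => by positivity)
      ⟨i, Finset.mem_univ i, pow_pos (norm_pos_iff.mpr hi) 2⟩
    exact (norm_nonneg _).lt_of_ne' fun h0 => by simp [h0] at hsq
  have hle : δ * ‖J v‖ ≤ ‖T - R‖ * ‖J v‖ := by
    calc δ * ‖J v‖ ≤ ‖T (J v)‖ := by
          refine le_of_sq_le_sq ?_ (norm_nonneg _)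
          rw [mul_pow, hJnorm, Finset.mul_sum]
          refine (Finset.sum_le_sum fun i _ => ?_).trans hlow
          rw [norm_mul, mul_pow]
          gcongr
          exact hd i
      _ = ‖(T - R) (J v)‖ := by simp [hRv]
      _ ≤ _ := (T - R).le_opNorm _
  exact le_of_mul_le_mul_right hle hpos

theorem stmt4 (c₀ : ℕ) (hc₀ : 2 ≤ c₀) (ψ : ℂ → ℂ) (c : ℕ → ℂ) (hconv : DSConvUnif c ψ)
    (hmap : (∀ s : ℂ, 0 < s.re → ψ s = 0) ∨ (∀ s : ℂ, 0 < s.re → 0 < (ψ s).re))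
    (T : H2 →L[ℂ] H2) (hT : IsCompOp (fun s => (c₀ : ℂ) * s + ψ s) T)
    (hcpt : IsCompactOperator ⇑T) :
    ∃ A : ℝ, 0 < A ∧ ∃ C : ℝ, 0 < C ∧ ∀ n : ℕ, 1 ≤ n →
      C * (n : ℝ) ^ (-A) ≤ approxNumber T n := by
  have hcabs := hconv.abscissaOfAbsConv_lt_top
  obtain ⟨τ, hτ, -⟩ := EReal.exists_between_coe_real hcabs
  have hseries (m : ℕ+) (s : ℂ) (hs : max (1 / 2) τ < s.re) :
      LSeries (H2coeff (T (lp.single 2 m 1))) s =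
        ((m ^ c₀ : ℕ) : ℂ) ^ (-s) * exp (-log m * LSeries c s) := by
    have hs1 := (le_max_left _ _).trans_lt hs
    have hs2 := (le_max_right _ _).trans_lt hs
    have hm : (m : ℂ) ≠ 0 := Nat.cast_ne_zero.mpr m.ne_zero
    rw [← H2series_eq_LSeries, hT _ s hs1, H2series_single]
    beta_reduce
    rw [hconv.eq_LSeries (by linarith)
      (LSeriesSummable_of_abscissaOfAbsConv_lt_re (hτ.trans (EReal.coe_lt_coe_iff.mpr hs2))),
      neg_add, cpow_add _ _ hm, cpow_def_of_ne_zero hm (-LSeries c s), Nat.cast_pow,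
      ← natCast_cpow_natCast_mul]
    ring_nf
  have hMne (m : ℕ+) : (m : ℕ) ^ c₀ ≠ 0 := pow_ne_zero _ m.ne_zero
  have hdiag (m : ℕ+) : T (lp.single 2 m 1) (m ^ c₀) = exp (-log m * c 1) := by
    rw [← LSeries_coeff_eq_exp_of_eq_cpow_mul_exp (hMne m) (H2coeff_zero _)
      (abscissaOfAbsConv_H2coeff_lt_top _) hcabs (hseries m), ← PNat.pow_coe, H2coeff_coe]
  have hoff (m k : ℕ+) (hmk : ¬ (m : ℕ) ∣ k) : T (lp.single 2 m 1) (k ^ c₀) = 0 := by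
    rw [← H2coeff_coe]
    refine LSeries_coeff_eq_zero_of_eq_cpow_mul_exp (hMne m)
      (abscissaOfAbsConv_H2coeff_lt_top _) hcabs (hseries m) (PNat.ne_zero _) ?_
    rwa [PNat.pow_coe, Nat.pow_dvd_pow_iff (by omega)]
  set A : ℝ := |(c 1).re| + 1 with hA
  have hA0 : 0 < A := by positivity
  refine ⟨A, hA0, 2 ^ (-A), by positivity, fun N hN => ?_⟩
  rw [← Real.mul_rpow zero_le_two (Nat.cast_nonneg N)]
  let a : Fin N → ℕ+ := fun i => ⟨N + i, by omega⟩
  have ha : a.Injective := fun i j hij => by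
    have := congrArg PNat.val hij
    simp only [a, PNat.mk_coe] at this
    omega
  refine le_approxNumber_of_diagonal T hN ha (b := fun i => a i ^ c₀) (fun i j hij => ha ?_)
    (by positivity) (fun i => ?_) (fun i => hdiag (a i)) fun i j hij => hoff _ _ fun hd => hij ?_
  · exact PNat.coe_injective (Nat.pow_left_injective (by omega : c₀ ≠ 0)
      (by simpa using congrArg PNat.val hij))
  · have hai : (1 : ℝ) ≤ (a i : ℕ) := by exact_mod_cast one_le
    have hai' : ((a i : ℕ) : ℝ) ≤ 2 * N := by
      have : (a i : ℕ) ≤ 2 * N := by simp only [a, PNat.mk_coe]; omega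
      exact_mod_cast this
    rw [norm_exp, ← natCast_log, ← ofReal_neg, re_ofReal_mul, neg_mul, ← mul_neg,
      ← Real.rpow_def_of_pos (by positivity)]
    calc (2 * (N : ℝ)) ^ (-A) ≤ ((a i : ℕ) : ℝ) ^ (-A) :=
          Real.rpow_le_rpow_of_nonpos (by positivity) hai' (by linarith)
      _ ≤ _ := Real.rpow_le_rpow_of_exponent_le hai (by linarith [le_abs_self (c 1).re])
  · obtain ⟨k, hk⟩ := hd
    simp only [a, PNat.mk_coe] at hk
    have hk1 : k = 1 := by
      have := i.2
      rcases k with _ | _ | k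
      · omega
      · rfl
      · nlinarith
    subst hk1
    ext
    omega
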